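/- arXiv:math/0610564 — 3 statements merged into one kernel-verified Lean document; each statement's English description precedes it below -/
import Mathlib

section
/- For all a, b > 0 and all t > 0: ∫_0^t D_a(s)·D_b(t−s) ds = D_{a+b}(t), i.e. the family of functions (D_a)_{a>0} is a convolution semigroup in the parameter a. -/
open MeasureTheory

noncomputable section

/-- `D a u = (a/√(2πu³)) exp(-a²/(2u))`, the density of the first hitting time of `0`
by a Brownian motion started at `a`. -/
def D (a u : ℝ) : ℝ :=
  a / Real.sqrt (2 * Real.pi * u ^ 3) * Real.exp (-a ^ 2 / (2 * u))

open Filter Topology Set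

/-- The integral of `exp (-u²/2)` from `0` to `x`. -/
def gaussPrimitive (x : ℝ) : ℝ := ∫ u in (0:ℝ)..x, Real.exp (-(1 / 2) * u ^ 2)

lemma hasDerivAt_gaussPrimitive (x : ℝ) :
    HasDerivAt gaussPrimitive (Real.exp (-(1 / 2) * x ^ 2)) x := by
  have hc : Continuous fun u : ℝ => Real.exp (-(1 / 2) * u ^ 2) := by fun_prop
  exact hc.integral_hasStrictDerivAt 0 x |>.hasDerivAt

lemma gaussPrimitive_neg (x : ℝ) : gaussPrimitive (-x) = -gaussPrimitive x := by
  have h := intervalIntegral.integral_comp_neg (a := 0) (b := x)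
    (fun u : ℝ => Real.exp (-(1 / 2) * u ^ 2))
  simp only [neg_sq, neg_zero] at h
  rw [gaussPrimitive, gaussPrimitive, intervalIntegral.integral_symm, h]

lemma tendsto_gaussPrimitive_atTop :
    Tendsto gaussPrimitive atTop (𝓝 (√(2 * Real.pi) / 2)) := by
  have h := intervalIntegral_tendsto_integral_Ioi (0 : ℝ)
    (integrable_exp_neg_mul_sq (b := 1 / 2) (by norm_num)).integrableOn tendsto_id
  rw [integral_gaussian_Ioi, div_div_eq_mul_div, div_one, mul_comm Real.pi] at h
  exact h

lemma tendsto_gaussPrimitive_atBot :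
    Tendsto gaussPrimitive atBot (𝓝 (-(√(2 * Real.pi) / 2))) := by
  refine (tendsto_gaussPrimitive_atTop.comp tendsto_neg_atBot_atTop).neg.congr fun x => ?_
  simp [gaussPrimitive_neg]

/-- For `0 < s < t` this equals `(a(t-s) - bs)/√(ts(t-s))`, the normalized position appearing when
the square is completed in `a²/s + b²/(t-s)`. -/
def bridgeVar (t a b s : ℝ) : ℝ := (a * (√(t - s) / √s) - b * (√s / √(t - s))) / √t

lemma bridgeVar_reflect (t a b s : ℝ) : bridgeVar t a b s = bridgeVar t (-b) (-a) (t - s) := by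
  simp only [bridgeVar, sub_sub_cancel]
  ring

lemma bridgeVar_neg (t a b s : ℝ) : bridgeVar t (-a) (-b) s = -bridgeVar t a b s := by
  simp only [bridgeVar]
  ring

lemma hasDerivAt_bridgeVar {t s : ℝ} (a b : ℝ) (hs : 0 < s) (hst : s < t) :
    HasDerivAt (bridgeVar t a b)
      (-√t * (a * (t - s) + b * s) / (2 * √s ^ 3 * √(t - s) ^ 3)) s := by
  have hts : 0 < t - s := sub_pos.2 hst
  have ht : 0 < t := hs.trans hst
  have hp := Real.sqrt_pos.2 hs
  have hq := Real.sqrt_pos.2 hts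
  have hT := Real.sqrt_pos.2 ht
  have h1 : HasDerivAt (fun x : ℝ => √x) (1 / (2 * √s)) s := (hasDerivAt_id s).sqrt hs.ne'
  have h2 : HasDerivAt (fun x : ℝ => √(t - x)) (-1 / (2 * √(t - s))) s :=
    ((hasDerivAt_id s).const_sub t).sqrt hts.ne'
  have h := (((h2.div h1 hp.ne').const_mul a).sub ((h1.div h2 hq.ne').const_mul b)).div_const √t
  refine h.congr_deriv ?_
  have e1 : s = √s ^ 2 := (Real.sq_sqrt hs.le).symm
  have e2 : t - s = √(t - s) ^ 2 := (Real.sq_sqrt hts.le).symm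
  have e3 : √t ^ 2 = √s ^ 2 + √(t - s) ^ 2 := by
    rw [Real.sq_sqrt ht.le, Real.sq_sqrt hts.le, Real.sq_sqrt hs.le]; ring
  have e4 : a * (t - s) + b * s = a * √(t - s) ^ 2 + b * √s ^ 2 := by rw [← e1, ← e2]
  rw [e4]
  generalize √s = p at *
  generalize √(t - s) = q at *
  generalize √t = T at *
  field_simp
  rw [e3]
  ring

lemma tendsto_bridgeVar_zero {t a : ℝ} (b : ℝ) (ht : 0 < t) (ha : 0 < a) :
    Tendsto (bridgeVar t a b) (𝓝[>] 0) atTop := by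
  have hT := Real.sqrt_pos.2 ht
  have hp : Tendsto (fun s : ℝ => √s) (𝓝[>] 0) (𝓝 0) := by
    have : Tendsto (fun s : ℝ => √s) (𝓝 0) (𝓝 √0) := Real.continuous_sqrt.tendsto 0
    rw [Real.sqrt_zero] at this
    exact this.mono_left nhdsWithin_le_nhds
  have hp' : Tendsto (fun s : ℝ => √s) (𝓝[>] 0) (𝓝[>] 0) :=
    tendsto_nhdsWithin_iff.2 ⟨hp, by
      filter_upwards [self_mem_nhdsWithin] with s hs using Real.sqrt_pos.2 hs⟩
  have hq : Tendsto (fun s : ℝ => √(t - s)) (𝓝[>] 0) (𝓝 √t) := by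
    have hc : Continuous fun s : ℝ => √(t - s) := by fun_prop
    have := hc.tendsto 0
    simp only [sub_zero] at this
    exact this.mono_left nhdsWithin_le_nhds
  have h1 : Tendsto (fun s : ℝ => √(t - s) / √s) (𝓝[>] 0) atTop :=
    hq.pos_mul_atTop hT (tendsto_inv_nhdsGT_zero.comp hp')
  have h2 : Tendsto (fun s : ℝ => -(b * (√s / √(t - s)))) (𝓝[>] 0) (𝓝 (-(b * (0 / √t)))) :=
    ((hp.div hq hT.ne').const_mul b).neg
  have h3 := ((h1.const_mul_atTop ha).atTop_add h2).atTop_div_const hT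
  exact h3.congr fun s => by simp only [bridgeVar]; ring

lemma tendsto_bridgeVar_right {t b : ℝ} (a : ℝ) (ht : 0 < t) (hb : b < 0) :
    Tendsto (bridgeVar t a b) (𝓝[<] t) atTop := by
  have h : Tendsto (fun s : ℝ => t - s) (𝓝[<] t) (𝓝[>] 0) := by
    refine tendsto_nhdsWithin_iff.2 ⟨?_, ?_⟩
    · have hc : Continuous fun s : ℝ => t - s := by fun_prop
      have := hc.tendsto t
      rw [sub_self] at this
      exact this.mono_left nhdsWithin_le_nhds
    · filter_upwards [self_mem_nhdsWithin] with s hs using sub_pos.2 (mem_Iio.1 hs)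
  exact ((tendsto_bridgeVar_zero (-a) ht (neg_pos.2 hb)).comp h).congr
    fun s => (bridgeVar_reflect t a b s).symm

lemma bridgeVar_sq {t s : ℝ} (a b : ℝ) (hs : 0 < s) (hst : s < t) :
    bridgeVar t a b s ^ 2 = a ^ 2 / s + b ^ 2 / (t - s) - (a + b) ^ 2 / t := by
  have hts : 0 < t - s := sub_pos.2 hst
  have ht : 0 < t := hs.trans hst
  have hp := Real.sqrt_pos.2 hs
  have hq := Real.sqrt_pos.2 hts
  have e : bridgeVar t a b s =
      (a * √(t - s) ^ 2 - b * √s ^ 2) / (√s * √(t - s) * √t) := by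
    simp only [bridgeVar]
    field_simp
  rw [e, div_pow, mul_pow, mul_pow, Real.sq_sqrt hs.le, Real.sq_sqrt hts.le, Real.sq_sqrt ht.le]
  field_simp
  ring

lemma sqrt_two_pi_mul_cube {u : ℝ} (hu : 0 ≤ u) :
    √(2 * Real.pi * u ^ 3) = √(2 * Real.pi) * √u ^ 3 := by
  have h : √(u ^ 3) = √u ^ 3 := by
    rw [Real.sqrt_eq_iff_eq_sq (by positivity) (by positivity), ← pow_mul, mul_comm 3 2, pow_mul,
      Real.sq_sqrt hu]
  rw [Real.sqrt_mul (by positivity), h]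

/-- A primitive of `s ↦ D a s * D b (t - s)` on `(0, t)`. -/
def convPrimitive (a b t s : ℝ) : ℝ :=
  -(Real.exp (-(a + b) ^ 2 / (2 * t)) / (2 * Real.pi * √t ^ 3)) *
    ((a + b) * gaussPrimitive (bridgeVar t a b s) +
      (b - a) * Real.exp (2 * a * b / t) * gaussPrimitive (bridgeVar t a (-b) s))

lemma hasDerivAt_convPrimitive {t s : ℝ} (a b : ℝ) (hs : 0 < s) (hst : s < t) :
    HasDerivAt (convPrimitive a b t) (D a s * D b (t - s)) s := by
  have hts : 0 < t - s := sub_pos.2 hst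
  have ht : 0 < t := hs.trans hst
  have hp := Real.sqrt_pos.2 hs
  have hq := Real.sqrt_pos.2 hts
  have hT := Real.sqrt_pos.2 ht
  have h1 := (hasDerivAt_gaussPrimitive _).comp s (hasDerivAt_bridgeVar a b hs hst)
  have h2 := (hasDerivAt_gaussPrimitive _).comp s (hasDerivAt_bridgeVar a (-b) hs hst)
  refine (((h1.const_mul (a + b)).add
    (h2.const_mul ((b - a) * Real.exp (2 * a * b / t)))).const_mul
    (-(Real.exp (-(a + b) ^ 2 / (2 * t)) / (2 * Real.pi * √t ^ 3)))).congr_deriv ?_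
  have e1 : Real.exp (2 * a * b / t) * Real.exp (-(1 / 2) * bridgeVar t a (-b) s ^ 2) =
      Real.exp (-(1 / 2) * bridgeVar t a b s ^ 2) := by
    rw [← Real.exp_add, bridgeVar_sq a b hs hst, bridgeVar_sq a (-b) hs hst]
    congr 1
    ring
  have e2 : Real.exp (-a ^ 2 / (2 * s)) * Real.exp (-b ^ 2 / (2 * (t - s))) =
      Real.exp (-(a + b) ^ 2 / (2 * t)) * Real.exp (-(1 / 2) * bridgeVar t a b s ^ 2) := by
    rw [← Real.exp_add, ← Real.exp_add, bridgeVar_sq a b hs hst]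
    congr 1
    field_simp
    ring
  have e3 : D a s * D b (t - s) = a * b / (2 * Real.pi * √s ^ 3 * √(t - s) ^ 3) *
      (Real.exp (-(a + b) ^ 2 / (2 * t)) * Real.exp (-(1 / 2) * bridgeVar t a b s ^ 2)) := by
    rw [← e2, D, D, sqrt_two_pi_mul_cube hs.le, sqrt_two_pi_mul_cube hts.le]
    have hpi : √(2 * Real.pi) ^ 2 = 2 * Real.pi := Real.sq_sqrt (by positivity)
    generalize √(2 * Real.pi) = r at hpi ⊢
    rw [← hpi]
    ring
  have e4 : √t ^ 2 = t := Real.sq_sqrt ht.le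
  rw [e3, mul_assoc (b - a), ← mul_assoc (Real.exp (2 * a * b / t)), e1]
  have hpi := Real.pi_pos
  generalize Real.exp _ = E₁
  generalize Real.exp _ = E₂
  generalize √s = p at *
  generalize √(t - s) = q at *
  generalize √t = T at *
  field_simp
  rw [e4]
  ring

/-- for `a, b, t > 0`, `∫_0^t D_a(s) D_b(t-s) ds = D_{a+b}(t)`:
the family `(D_a)_{a>0}` is a convolution semigroup in the parameter `a`. -/
theorem stmt7 (a b t : ℝ) (ha : 0 < a) (hb : 0 < b) (ht : 0 < t) :
    ∫ s in Set.Ioo (0:ℝ) t, D a s * D b (t - s) = D (a + b) t := by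
  have hderiv : ∀ s ∈ Ioo 0 t, HasDerivAt (convPrimitive a b t) (D a s * D b (t - s)) s :=
    fun s hs => hasDerivAt_convPrimitive a b hs.1 hs.2
  have hleft := (((tendsto_gaussPrimitive_atTop.comp
    (tendsto_bridgeVar_zero b ht ha)).const_mul (a + b)).add
    ((tendsto_gaussPrimitive_atTop.comp (tendsto_bridgeVar_zero (-b) ht ha)).const_mul
      ((b - a) * Real.exp (2 * a * b / t)))).const_mul
    (-(Real.exp (-(a + b) ^ 2 / (2 * t)) / (2 * Real.pi * √t ^ 3)))
  have hbot : Tendsto (bridgeVar t a b) (𝓝[<] t) atBot :=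
    (tendsto_neg_atTop_atBot.comp (tendsto_bridgeVar_right (-a) ht (neg_lt_zero.2 hb))).congr
      fun s => by simp [bridgeVar_neg]
  have hright := (((tendsto_gaussPrimitive_atBot.comp hbot).const_mul (a + b)).add
    ((tendsto_gaussPrimitive_atTop.comp
      (tendsto_bridgeVar_right a ht (neg_lt_zero.2 hb))).const_mul
      ((b - a) * Real.exp (2 * a * b / t)))).const_mul
    (-(Real.exp (-(a + b) ^ 2 / (2 * t)) / (2 * Real.pi * √t ^ 3)))
  have hint : IntervalIntegrable (fun s => D a s * D b (t - s)) volume 0 t := by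
    rw [intervalIntegrable_iff_integrableOn_Ioc_of_le ht.le]
    refine intervalIntegral.integrableOn_deriv_of_nonneg
      (g := extendFrom (Ioo 0 t) (convPrimitive a b t))
      (continuousOn_Icc_extendFrom_Ioo
        (fun s hs => (hderiv s hs).continuousAt.continuousWithinAt) hleft hright)
      (fun s hs => (hderiv s hs).congr_of_eventuallyEq ?_) (fun s hs => ?_)
    · filter_upwards [Ioo_mem_nhds hs.1 hs.2] with x hx
      exact extendFrom_eq (subset_closure hx)
        ((hderiv x hx).continuousAt.tendsto.mono_left nhdsWithin_le_nhds)
    · simp only [D]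
      positivity
  rw [← integral_Ioc_eq_integral_Ioo, ← intervalIntegral.integral_of_le ht.le,
    intervalIntegral.integral_eq_sub_of_hasDerivAt_of_tendsto ht hderiv hint hleft hright,
    D, sqrt_two_pi_mul_cube ht.le]
  have hpi : √(2 * Real.pi) ^ 2 = 2 * Real.pi := Real.sq_sqrt (by positivity)
  have hpi0 : 0 < √(2 * Real.pi) := by positivity
  have hT := Real.sqrt_pos.2 ht
  generalize √(2 * Real.pi) = r at hpi hpi0 ⊢
  rw [← hpi]
  field_simp
  ring

end
end

section
/- For all β, γ ∈ ℝ there exists a constant D(β,γ) ≥ 0 such that for every t ≥ 1 and every x ≥ 0: J*(β,x,t) ≤ D(β,γ)·sinh((β⁺ + 1)·x)·I*(β,γ,0,t), where β⁺ = max(β,0). -/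
noncomputable section

/-- The function J*(β,x,t). -/
def Jstar (β x t : ℝ) : ℝ :=
  if β = 0 then Real.sqrt (2 / (Real.pi * t)) * x
  else Real.sqrt (2 / (Real.pi * t ^ 3)) * x / β ^ 2 +
    (if 0 < β then 2 * Real.sinh (β * x) * Real.exp (t * β ^ 2 / 2) else 0)

/-- The function I*(β,γ,x,t), defined by cases. -/
def Istar (β γ x t : ℝ) : ℝ :=
  if β < 0 ∧ γ < 0 then
    Real.sqrt (2 / (Real.pi * t ^ 3)) * (x / (β * γ) + (|β| + |γ|) / (β ^ 2 * γ ^ 2))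
  else if β = 0 ∧ γ < 0 then (1 / |γ|) * Real.sqrt (2 / (Real.pi * t))
  else if γ = 0 ∧ β < 0 then (1 / |β|) * Real.sqrt (2 / (Real.pi * t))
  else if β = 0 ∧ γ = 0 then 1
  else if 0 < β ∧ γ < β then
    (1 / (β - γ)) * Real.sqrt (2 / (Real.pi * t)) +
      (2 * β / (β - γ)) * Real.exp (-β * x + t * β ^ 2 / 2)
  else if 0 < γ ∧ β < γ then
    (1 / (γ - β)) * Real.sqrt (2 / (Real.pi * t)) +
      (2 * γ / (γ - β)) * Real.exp (-γ * x + t * γ ^ 2 / 2)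
  else
    γ * Real.sqrt (2 * t / Real.pi) +
      2 * (t * γ ^ 2 + 1) * Real.exp (-γ * x + t * γ ^ 2 / 2)

theorem sqrt_two_div_pi_mul_le_one {t : ℝ} (ht : 1 ≤ t) : √(2 / (Real.pi * t)) ≤ 1 := by
  rw [Real.sqrt_le_one, div_le_one (by positivity)]
  nlinarith [Real.pi_gt_three]

theorem sqrt_two_div_pi_mul_cube_le {t : ℝ} (ht : 1 ≤ t) :
    √(2 / (Real.pi * t ^ 3)) ≤ √(2 / (Real.pi * t)) := by
  gcongr
  exact le_self_pow₀ ht (by norm_num)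

/-- Away from the case of two negative parameters, `I*(β,γ,0,t)` decays no faster than
`t ^ (-1/2)`. -/
theorem exists_sqrt_le_mul_Istar {β γ : ℝ} (h : ¬(β < 0 ∧ γ < 0)) :
    ∃ D ≥ (0 : ℝ), ∀ t ≥ (1 : ℝ), √(2 / (Real.pi * t)) ≤ D * Istar β γ 0 t := by
  unfold Istar
  split_ifs with h₂ h₃ h₄ h₅ h₆
  · have := h₂.2.ne
    refine ⟨|γ|, abs_nonneg _, fun t _ ↦ le_of_eq ?_⟩
    field_simp
  · have := h₃.2.ne
    refine ⟨|β|, abs_nonneg _, fun t _ ↦ le_of_eq ?_⟩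
    field_simp
  · exact ⟨1, zero_le_one, fun t ht ↦ by simpa using sqrt_two_div_pi_mul_le_one ht⟩
  · have hd := sub_pos.2 h₅.2
    have := h₅.1
    refine ⟨β - γ, hd.le, fun t _ ↦ ?_⟩
    rw [mul_add, ← mul_assoc, mul_one_div_cancel hd.ne', one_mul]
    exact le_add_of_nonneg_right (by positivity)
  · have hd := sub_pos.2 h₆.2
    have := h₆.1
    refine ⟨γ - β, hd.le, fun t _ ↦ ?_⟩
    rw [mul_add, ← mul_assoc, mul_one_div_cancel hd.ne', one_mul]
    exact le_add_of_nonneg_right (by positivity)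
  · have hγ : 0 ≤ γ := by
      by_contra! hγ
      rcases lt_trichotomy β 0 with hβ | hβ | hβ
      · exact h ⟨hβ, hγ⟩
      · exact h₂ ⟨hβ, hγ⟩
      · exact h₅ ⟨hβ, hγ.trans hβ⟩
    refine ⟨1, zero_le_one, fun t ht ↦ (sqrt_two_div_pi_mul_le_one ht).trans ?_⟩
    have h₁ : 1 ≤ Real.exp (-γ * 0 + t * γ ^ 2 / 2) := Real.one_le_exp (by
      rw [mul_zero, zero_add]
      positivity)
    have h₂ : 0 ≤ γ * √(2 * t / Real.pi) := by positivity
    have h₃ : 0 ≤ t * γ ^ 2 := by positivity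
    nlinarith

/-- For `β ≠ 0`, `I*(β,γ,0,t)` decays no faster than `t ^ (-3/2)`. -/
theorem exists_sqrt_cube_le_mul_Istar {β : ℝ} (hβ : β ≠ 0) (γ : ℝ) :
    ∃ D ≥ (0 : ℝ), ∀ t ≥ (1 : ℝ), √(2 / (Real.pi * t ^ 3)) ≤ D * Istar β γ 0 t := by
  by_cases h : β < 0 ∧ γ < 0
  · have hβ := abs_pos.2 hβ
    have hγ := abs_pos.2 h.2.ne
    have hc : 0 < (|β| + |γ|) / (β ^ 2 * γ ^ 2) := by
      rw [← sq_abs β, ← sq_abs γ]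
      positivity
    refine ⟨((|β| + |γ|) / (β ^ 2 * γ ^ 2))⁻¹, by positivity, fun t _ ↦ le_of_eq ?_⟩
    rw [Istar, if_pos h, zero_div, zero_add, mul_left_comm, inv_mul_cancel₀ hc.ne', mul_one]
  · obtain ⟨D, hD, hle⟩ := exists_sqrt_le_mul_Istar h
    exact ⟨D, hD, fun t ht ↦ (sqrt_two_div_pi_mul_cube_le ht).trans (hle t ht)⟩

/-- For `β > 0`, `I*(β,γ,0,t)` grows at least as fast as `exp (t β² / 2)`. -/
theorem exists_exp_le_mul_Istar {β : ℝ} (hβ : 0 < β) (γ : ℝ) :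
    ∃ D ≥ (0 : ℝ), ∀ t ≥ (1 : ℝ), Real.exp (t * β ^ 2 / 2) ≤ D * Istar β γ 0 t := by
  rcases lt_trichotomy γ β with h | rfl | h
  · have hd := sub_pos.2 h
    refine ⟨(2 * β / (β - γ))⁻¹, by positivity, fun t _ ↦ ?_⟩
    rw [Istar, if_neg (by grind), if_neg (by grind), if_neg (by grind), if_neg (by grind),
      if_pos ⟨hβ, h⟩, mul_add, inv_mul_cancel_left₀ (by positivity), mul_zero, zero_add]
    exact le_add_of_nonneg_left (by positivity)
  · refine ⟨1, zero_le_one, fun t ht ↦ ?_⟩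
    rw [Istar, if_neg (by grind), if_neg (by grind), if_neg (by grind), if_neg (by grind),
      if_neg (by grind), if_neg (by grind), one_mul, mul_zero, zero_add]
    have h₁ := Real.exp_pos (t * γ ^ 2 / 2)
    have h₂ : 0 ≤ γ * √(2 * t / Real.pi) := by positivity
    have h₃ : 0 ≤ t * γ ^ 2 := by positivity
    nlinarith
  · have hd := sub_pos.2 h
    have hγ := hβ.trans h
    refine ⟨(2 * γ / (γ - β))⁻¹, by positivity, fun t _ ↦ ?_⟩
    rw [Istar, if_neg (by grind), if_neg (by grind), if_neg (by grind), if_neg (by grind),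
      if_neg (by grind), if_pos ⟨hγ, h⟩, mul_add, inv_mul_cancel_left₀ (by positivity),
      mul_zero, zero_add]
    have : Real.exp (t * β ^ 2 / 2) ≤ Real.exp (t * γ ^ 2 / 2) := by gcongr
    exact this.trans (le_add_of_nonneg_left (by positivity))

/-- for all `β, γ` there is `D(β,γ) ≥ 0` with
`J*(β,x,t) ≤ D(β,γ) sinh((β⁺+1)x) I*(β,γ,0,t)` for all `t ≥ 1`, `x ≥ 0`. -/
theorem stmt9 (β γ : ℝ) :
    ∃ D ≥ (0:ℝ), ∀ t ≥ (1:ℝ), ∀ x ≥ (0:ℝ),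
      Jstar β x t ≤ D * Real.sinh ((max β 0 + 1) * x) * Istar β γ 0 t := by
  have hlin (x : ℝ) (hx : 0 ≤ x) : x ≤ Real.sinh ((max β 0 + 1) * x) := by
    have h : x ≤ (max β 0 + 1) * x := le_mul_of_one_le_left hx (by simp)
    exact h.trans (Real.self_le_sinh_iff.2 (hx.trans h))
  rcases eq_or_ne β 0 with rfl | hβ
  · obtain ⟨D, hD, hle⟩ := exists_sqrt_le_mul_Istar (β := 0) (γ := γ) (by simp)
    refine ⟨D, hD, fun t ht x hx ↦ ?_⟩
    rw [Jstar, if_pos rfl, mul_right_comm]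
    exact mul_le_mul (hle t ht) (hlin x hx) hx ((Real.sqrt_nonneg _).trans (hle t ht))
  obtain ⟨D, hD, hle⟩ := exists_sqrt_cube_le_mul_Istar hβ γ
  have hpoly (t : ℝ) (ht : 1 ≤ t) (x : ℝ) (hx : 0 ≤ x) :
      √(2 / (Real.pi * t ^ 3)) * x / β ^ 2 ≤
        D / β ^ 2 * Real.sinh ((max β 0 + 1) * x) * Istar β γ 0 t := by
    calc √(2 / (Real.pi * t ^ 3)) * x / β ^ 2
        ≤ D * Istar β γ 0 t * Real.sinh ((max β 0 + 1) * x) / β ^ 2 := by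
          gcongr
          · exact (Real.sqrt_nonneg _).trans (hle t ht)
          · exact hle t ht
          · exact hlin x hx
      _ = _ := by ring
  by_cases hpos : 0 < β
  · obtain ⟨D', hD', hle'⟩ := exists_exp_le_mul_Istar hpos γ
    refine ⟨D / β ^ 2 + 2 * D', by positivity, fun t ht x hx ↦ ?_⟩
    rw [Jstar, if_neg hβ, if_pos hpos, add_mul, add_mul]
    refine add_le_add (hpoly t ht x hx) ?_
    have hsinh : Real.sinh (β * x) ≤ Real.sinh ((max β 0 + 1) * x) :=
      Real.sinh_le_sinh.2 (mul_le_mul_of_nonneg_right (by linarith [le_max_left β 0]) hx)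
    calc 2 * Real.sinh (β * x) * Real.exp (t * β ^ 2 / 2)
        ≤ 2 * Real.sinh ((max β 0 + 1) * x) * (D' * Istar β γ 0 t) := by
          have := hx.trans (hlin x hx)
          gcongr
          exact hle' t ht
      _ = _ := by ring
  · refine ⟨D / β ^ 2, by positivity, fun t ht x hx ↦ ?_⟩
    rw [Jstar, if_neg hβ, if_neg hpos, add_zero]
    exact hpoly t ht x hx

end
end

section
/- Fix x ≥ 0 and k ∈ E. As u → ∞, Z*(α,γ,x,k,u) is equivalent (ratio tending to 1) to: (1) 2·(Σ_{m∈J} μ_m)·u·γ²·exp(−γx + uγ²/2), if γ > 0, γ ≥ α_m for all m ∈ E, and J = {m ∈ E : α_m = γ} is nonempty; (2) (Σ_{m∈E} 2γ·μ_m/(γ−α_m))·exp(−γx + uγ²/2), if γ > 0 and γ > α_m for all m ∈ E; (3) exp(u·ᾱ²/2)·((2ᾱ/(ᾱ−γ))·(Σ_{m∈J} μ_m)·exp(−ᾱx) + 2·sinh(ᾱx)·1_{k∈J}), if ᾱ := max_{m∈E} α_m satisfies ᾱ > γ and ᾱ > 0, with J = {m ∈ E : α_m = ᾱ}; (4) Σ_{m∈J}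 μ_m, if γ = 0, J = {m ∈ E : α_m = 0} is nonempty, and α_m < 0 for all m ∉ J; (5) √(2/(πu))·Σ_{m∈E} μ_m/|α_m|, if γ = 0 and α_m < 0 for all m ∈ E; (6) √(2/(πu))·((Σ_{m∈J} μ_m)/|γ| + x·1_{k∈J}), if γ < 0, J = {m ∈ E : α_m = 0} is nonempty, and α_m < 0 for all m ∉ J; (7) √(2/(πu³))·(Σ_{m∈E} μ_m·(|α_m|+|γ|)/(α_m²γ²) + x·(1/α_k² + Σ_{m∈E} μ_m/(α_m·γ))), if γ < 0 and α_m < 0 for all m ∈ E. -/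
open Filter

noncomputable section

/-- `Z*(α,γ,x,k,t) = Σ_m μ_m I*(α_m,γ,x,t) + J*(α_k,x,t)`. -/
def Zstar {E : Type} [Fintype E] (μ : E → ℝ) (α : E → ℝ) (γ x : ℝ) (k : E) (t : ℝ) : ℝ :=
  (∑ m, μ m * Istar (α m) γ x t) + Jstar (α k) x t

open Asymptotics in
theorem isLittleO_mul_exp_sq_half {b A : ℝ} (h : b ^ 2 < A ^ 2) :
    (fun u : ℝ => u * Real.exp (u * b ^ 2 / 2)) =o[atTop] fun u => Real.exp (u * A ^ 2 / 2) := by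
  have h1 := (isLittleO_pow_exp_pos_mul_atTop 1 (show 0 < (A ^ 2 - b ^ 2) / 2 by linarith)).mul_isBigO
    (isBigO_refl (fun u : ℝ => Real.exp (u * b ^ 2 / 2)) atTop)
  refine h1.congr (fun u => by rw [pow_one]) fun u => ?_
  rw [← Real.exp_add]
  ring_nf

open Asymptotics in
theorem isLittleO_const_id_mul {f g : ℝ → ℝ} (h : f =O[atTop] g) :
    f =o[atTop] fun u => u * g u := by
  have h1 : (fun _ : ℝ => (1 : ℝ)) =o[atTop] fun u : ℝ => u := isLittleO_const_id_atTop 1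
  simpa using h1.mul_isBigO h

open Asymptotics in
theorem isLittleO_exp_sq_half {b A : ℝ} (h : b ^ 2 < A ^ 2) :
    (fun u : ℝ => Real.exp (u * b ^ 2 / 2)) =o[atTop] fun u => Real.exp (u * A ^ 2 / 2) :=
  (isLittleO_const_id_mul (isBigO_refl _ _)).trans (isLittleO_mul_exp_sq_half h)

open Asymptotics in
theorem isLittleO_one_exp_sq_half {A : ℝ} (hA : 0 < A) :
    (fun _ : ℝ => (1 : ℝ)) =o[atTop] fun u => Real.exp (u * A ^ 2 / 2) := by
  have h := isLittleO_exp_sq_half (b := 0) (A := A) (by nlinarith)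
  simpa using h

open Asymptotics in
theorem isLittleO_sqrt_two_div_pi_mul_one :
    (fun u : ℝ => Real.sqrt (2 / (Real.pi * u))) =o[atTop] fun _ => (1 : ℝ) := by
  rw [isLittleO_one_iff]
  have h : Tendsto (fun u : ℝ => 2 / (Real.pi * u)) atTop (nhds 0) :=
    tendsto_const_nhds.div_atTop (tendsto_id.const_mul_atTop Real.pi_pos)
  simpa only [Real.sqrt_zero] using h.sqrt

open Asymptotics in
theorem isLittleO_sqrt_two_div_pi_mul_cube :
    (fun u : ℝ => Real.sqrt (2 / (Real.pi * u ^ 3))) =o[atTop]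
      fun u => Real.sqrt (2 / (Real.pi * u)) := by
  have h1 : (fun u : ℝ => u⁻¹) =o[atTop] fun _ => (1 : ℝ) :=
    (isLittleO_one_iff ℝ).2 tendsto_inv_atTop_zero
  have h2 := h1.mul_isBigO (isBigO_refl (fun u : ℝ => Real.sqrt (2 / (Real.pi * u))) atTop)
  refine h2.congr' ?_ (by simp)
  filter_upwards [eventually_gt_atTop 0] with u hu
  have : 2 / (Real.pi * u ^ 3) = (u⁻¹) ^ 2 * (2 / (Real.pi * u)) := by
    field_simp
  rw [this, Real.sqrt_mul (by positivity), Real.sqrt_sq (by positivity)]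

open Asymptotics in
theorem isLittleO_sqrt_two_div_pi_mul_cube_one :
    (fun u : ℝ => Real.sqrt (2 / (Real.pi * u ^ 3))) =o[atTop] fun _ => (1 : ℝ) :=
  isLittleO_sqrt_two_div_pi_mul_cube.trans isLittleO_sqrt_two_div_pi_mul_one

open Asymptotics in
theorem isBigO_sqrt_two_mul_div_pi :
    (fun u : ℝ => Real.sqrt (2 * u / Real.pi)) =O[atTop] fun u => u := by
  refine IsBigO.of_bound 1 ?_
  filter_upwards [eventually_ge_atTop 1] with u hu
  rw [Real.norm_of_nonneg (Real.sqrt_nonneg _), Real.norm_of_nonneg (by linarith), one_mul]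
  refine Real.sqrt_le_iff.2 ⟨by linarith, ?_⟩
  rw [div_le_iff₀ Real.pi_pos]
  nlinarith [Real.pi_gt_three, mul_nonneg (sub_nonneg.2 hu) (by linarith : (0 : ℝ) ≤ u)]

section JstarAsymptotics

open Asymptotics

theorem Jstar_zero (x t : ℝ) : Jstar 0 x t = Real.sqrt (2 / (Real.pi * t)) * x := by
  simp [Jstar]

theorem Jstar_of_neg {β : ℝ} (hβ : β < 0) (x t : ℝ) :
    Jstar β x t = x / β ^ 2 * Real.sqrt (2 / (Real.pi * t ^ 3)) := by
  rw [Jstar, if_neg hβ.ne, if_neg hβ.le.not_gt]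
  ring

theorem Jstar_of_pos {β : ℝ} (hβ : 0 < β) (x t : ℝ) :
    Jstar β x t = x / β ^ 2 * Real.sqrt (2 / (Real.pi * t ^ 3)) +
      2 * Real.sinh (β * x) * Real.exp (t * β ^ 2 / 2) := by
  rw [Jstar, if_neg hβ.ne', if_pos hβ]
  ring

theorem Jstar_isLittleO_sqrt_of_neg {β : ℝ} (hβ : β < 0) (x : ℝ) :
    Jstar β x =o[atTop] fun u => Real.sqrt (2 / (Real.pi * u)) := by
  rw [show Jstar β x = _ from funext (Jstar_of_neg hβ x)]
  exact isLittleO_sqrt_two_div_pi_mul_cube.const_mul_left _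

theorem Jstar_isLittleO_one_of_nonpos {β : ℝ} (hβ : β ≤ 0) (x : ℝ) :
    Jstar β x =o[atTop] fun _ => (1 : ℝ) := by
  rcases hβ.lt_or_eq with h | rfl
  · exact (Jstar_isLittleO_sqrt_of_neg h x).trans isLittleO_sqrt_two_div_pi_mul_one
  · rw [show Jstar 0 x = _ from funext (Jstar_zero x)]
    simpa only [mul_comm] using isLittleO_sqrt_two_div_pi_mul_one.const_mul_left x

theorem Jstar_leading_of_pos {β : ℝ} (hβ : 0 < β) (x : ℝ) :
    (fun u => Jstar β x u - 2 * Real.sinh (β * x) * Real.exp (u * β ^ 2 / 2)) =o[atTop]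
      fun u => Real.exp (u * β ^ 2 / 2) := by
  simp only [Jstar_of_pos hβ, add_sub_cancel_right]
  exact (isLittleO_sqrt_two_div_pi_mul_cube_one.trans
    (isLittleO_one_exp_sq_half hβ)).const_mul_left _

theorem Jstar_isBigO_exp {β : ℝ} (hβ : 0 < β) (x : ℝ) :
    Jstar β x =O[atTop] fun u => Real.exp (u * β ^ 2 / 2) := by
  have h := (Jstar_leading_of_pos hβ x).isBigO.add
    ((isBigO_refl (fun u : ℝ => Real.exp (u * β ^ 2 / 2)) atTop).const_mul_left
      (2 * Real.sinh (β * x)))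
  simpa using h

theorem Jstar_isLittleO_exp {β A : ℝ} (hβ : β < A) (hA : 0 < A) (x : ℝ) :
    Jstar β x =o[atTop] fun u => Real.exp (u * A ^ 2 / 2) := by
  rcases le_or_gt β 0 with h | h
  · exact (Jstar_isLittleO_one_of_nonpos h x).trans (isLittleO_one_exp_sq_half hA)
  · exact (Jstar_isBigO_exp h x).trans_isLittleO (isLittleO_exp_sq_half (by nlinarith))

end JstarAsymptotics

section IstarAsymptotics

open Asymptotics

theorem Istar_of_neg_of_neg {β γ : ℝ} (hβ : β < 0) (hγ : γ < 0) (x t : ℝ) :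
    Istar β γ x t = (x / (β * γ) + (|β| + |γ|) / (β ^ 2 * γ ^ 2)) *
      Real.sqrt (2 / (Real.pi * t ^ 3)) := by
  rw [Istar, if_pos ⟨hβ, hγ⟩, mul_comm]

theorem Istar_zero_of_neg {γ : ℝ} (hγ : γ < 0) (x t : ℝ) :
    Istar 0 γ x t = 1 / |γ| * Real.sqrt (2 / (Real.pi * t)) := by
  simp [Istar, hγ]

theorem Istar_of_neg_zero {β : ℝ} (hβ : β < 0) (x t : ℝ) :
    Istar β 0 x t = 1 / |β| * Real.sqrt (2 / (Real.pi * t)) := by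
  simp [Istar, hβ]

theorem Istar_zero_zero (x t : ℝ) : Istar 0 0 x t = 1 := by
  simp [Istar]

theorem Istar_of_lt_left {β γ : ℝ} (hβ : 0 < β) (h : γ < β) (x t : ℝ) :
    Istar β γ x t = 1 / (β - γ) * Real.sqrt (2 / (Real.pi * t)) +
      2 * β / (β - γ) * Real.exp (-β * x) * Real.exp (t * β ^ 2 / 2) := by
  simp [Istar, hβ, h, hβ.le.not_gt, hβ.ne', Real.exp_add, mul_assoc]

theorem Istar_of_lt_right {β γ : ℝ} (hγ : 0 < γ) (h : β < γ) (x t : ℝ) :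
    Istar β γ x t = 1 / (γ - β) * Real.sqrt (2 / (Real.pi * t)) +
      2 * γ / (γ - β) * Real.exp (-γ * x) * Real.exp (t * γ ^ 2 / 2) := by
  simp [Istar, hγ, h, hγ.le.not_gt, hγ.ne', h.le.not_gt, Real.exp_add, mul_assoc]

theorem Istar_self {γ : ℝ} (hγ : 0 < γ) (x t : ℝ) :
    Istar γ γ x t = γ * Real.sqrt (2 * t / Real.pi) +
      2 * Real.exp (-γ * x) * Real.exp (t * γ ^ 2 / 2) +
      2 * γ ^ 2 * Real.exp (-γ * x) * (t * Real.exp (t * γ ^ 2 / 2)) := by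
  simp only [Istar, hγ.le.not_gt, hγ.ne', lt_irrefl, and_false, if_false, Real.exp_add]
  ring

theorem Istar_leading_of_lt_left {β γ : ℝ} (hβ : 0 < β) (h : γ < β) (x : ℝ) :
    (fun u => Istar β γ x u - 2 * β / (β - γ) * Real.exp (-β * x) * Real.exp (u * β ^ 2 / 2))
      =o[atTop] fun u => Real.exp (u * β ^ 2 / 2) := by
  simp only [Istar_of_lt_left hβ h, add_sub_cancel_right]
  exact (isLittleO_sqrt_two_div_pi_mul_one.trans (isLittleO_one_exp_sq_half hβ)).const_mul_left _

theorem Istar_leading_of_lt_right {β γ : ℝ} (hγ : 0 < γ) (h : β < γ) (x : ℝ) :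
    (fun u => Istar β γ x u - 2 * γ / (γ - β) * Real.exp (-γ * x) * Real.exp (u * γ ^ 2 / 2))
      =o[atTop] fun u => Real.exp (u * γ ^ 2 / 2) := by
  simp only [Istar_of_lt_right hγ h, add_sub_cancel_right]
  exact (isLittleO_sqrt_two_div_pi_mul_one.trans (isLittleO_one_exp_sq_half hγ)).const_mul_left _

theorem Istar_isBigO_of_lt_left {β γ : ℝ} (hβ : 0 < β) (h : γ < β) (x : ℝ) :
    Istar β γ x =O[atTop] fun u => Real.exp (u * β ^ 2 / 2) := by
  have h := (Istar_leading_of_lt_left hβ h x).isBigO.add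
    ((isBigO_refl (fun u : ℝ => Real.exp (u * β ^ 2 / 2)) atTop).const_mul_left
      (2 * β / (β - γ) * Real.exp (-β * x)))
  simpa using h

theorem Istar_isBigO_of_lt_right {β γ : ℝ} (hγ : 0 < γ) (h : β < γ) (x : ℝ) :
    Istar β γ x =O[atTop] fun u => Real.exp (u * γ ^ 2 / 2) := by
  have h := (Istar_leading_of_lt_right hγ h x).isBigO.add
    ((isBigO_refl (fun u : ℝ => Real.exp (u * γ ^ 2 / 2)) atTop).const_mul_left
      (2 * γ / (γ - β) * Real.exp (-γ * x)))
  simpa using h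

theorem Istar_leading_self {γ : ℝ} (hγ : 0 < γ) (x : ℝ) :
    (fun u => Istar γ γ x u -
      2 * γ ^ 2 * Real.exp (-γ * x) * (u * Real.exp (u * γ ^ 2 / 2)))
      =o[atTop] fun u => u * Real.exp (u * γ ^ 2 / 2) := by
  simp only [Istar_self hγ, add_sub_cancel_right]
  refine IsLittleO.add (IsLittleO.const_mul_left ?_ _) (IsLittleO.const_mul_left ?_ _)
  · simpa using isBigO_sqrt_two_mul_div_pi.mul_isLittleO (isLittleO_one_exp_sq_half hγ)
  · exact isLittleO_const_id_mul (isBigO_refl _ _)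

theorem Istar_isBigO_self {γ : ℝ} (hγ : 0 < γ) (x : ℝ) :
    Istar γ γ x =O[atTop] fun u => u * Real.exp (u * γ ^ 2 / 2) := by
  have h := (Istar_leading_self hγ x).isBigO.add
    ((isBigO_refl (fun u : ℝ => u * Real.exp (u * γ ^ 2 / 2)) atTop).const_mul_left
      (2 * γ ^ 2 * Real.exp (-γ * x)))
  simpa using h

theorem Istar_isBigO_one_of_nonpos {β γ : ℝ} (hβ : β ≤ 0) (hγ : γ ≤ 0) (x : ℝ) :
    Istar β γ x =O[atTop] fun _ => (1 : ℝ) := by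
  rcases hβ.lt_or_eq with hβ | rfl <;> rcases hγ.lt_or_eq with hγ | rfl
  · simp only [show Istar β γ x = _ from funext (Istar_of_neg_of_neg hβ hγ x)]
    exact (isLittleO_sqrt_two_div_pi_mul_cube_one.const_mul_left _).isBigO
  · simp only [show Istar β 0 x = _ from funext (Istar_of_neg_zero hβ x)]
    exact (isLittleO_sqrt_two_div_pi_mul_one.const_mul_left _).isBigO
  · simp only [show Istar 0 γ x = _ from funext (Istar_zero_of_neg hγ x)]
    exact (isLittleO_sqrt_two_div_pi_mul_one.const_mul_left _).isBigO
  · simp only [show Istar 0 0 x = _ from funext (Istar_zero_zero x)]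
    exact isBigO_refl _ _

theorem Istar_isLittleO_exp {β γ A : ℝ} (hβ : β < A) (hγ : γ < A) (hA : 0 < A) (x : ℝ) :
    Istar β γ x =o[atTop] fun u => Real.exp (u * A ^ 2 / 2) := by
  by_cases h0 : β ≤ 0 ∧ γ ≤ 0
  · exact (Istar_isBigO_one_of_nonpos h0.1 h0.2 x).trans_isLittleO (isLittleO_one_exp_sq_half hA)
  rcases lt_trichotomy β γ with h | rfl | h
  · have hγ0 : 0 < γ := by grind
    exact (Istar_isBigO_of_lt_right hγ0 h x).trans_isLittleO (isLittleO_exp_sq_half (by nlinarith))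
  · have hβ0 : 0 < β := by grind
    exact (Istar_isBigO_self hβ0 x).trans_isLittleO (isLittleO_mul_exp_sq_half (by nlinarith))
  · have hβ0 : 0 < β := by grind
    exact (Istar_isBigO_of_lt_left hβ0 h x).trans_isLittleO (isLittleO_exp_sq_half (by nlinarith))

end IstarAsymptotics

open Asymptotics in
/-- If every summand of `Zstar` has a leading term that is a multiple of a common scale `d`, then
`Zstar` is asymptotically equivalent to the corresponding combination of these multiples. -/
theorem tendsto_Zstar_div {E : Type} [Fintype E] {μ α : E → ℝ} {γ x : ℝ} {k : E} {d D : ℝ → ℝ}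
    {c : E → ℝ} {j C : ℝ} (hd : ∀ᶠ u in atTop, d u ≠ 0)
    (hI : ∀ m, (fun u => Istar (α m) γ x u - c m * d u) =o[atTop] d)
    (hJ : (fun u => Jstar (α k) x u - j * d u) =o[atTop] d)
    (hC : ∑ m, μ m * c m + j = C) (hC0 : 0 < C) (hD : ∀ u, D u = d u * C) :
    Tendsto (fun u => Zstar μ α γ x k u / D u) atTop (nhds 1) := by
  have hsum : (fun u => ∑ m, μ m * (Istar (α m) γ x u - c m * d u)) =o[atTop] d := by
    simpa only [Finset.sum_fn] using
      IsLittleO.sum (s := Finset.univ) fun m _ => (hI m).const_mul_left (μ m)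
  have h : (fun u => Zstar μ α γ x k u - d u * C) =o[atTop] d := by
    refine (hsum.add hJ).congr_left fun u => ?_
    simp only [Zstar, ← hC, mul_sub, Finset.sum_sub_distrib, mul_add, ← mul_assoc,
      ← Finset.sum_mul]
    ring
  have hlim := (h.tendsto_div_nhds_zero.div_const C).add_const 1
  rw [zero_div, zero_add] at hlim
  refine hlim.congr' ?_
  filter_upwards [hd] with u hu
  rw [hD]
  field_simp
  ring

/-- the asymptotic equivalents of `u ↦ Z*(α,γ,x,k,u)` as `u → ∞`,
in the seven possible regimes of the parameters `(α,γ)`. -/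
theorem stmt12 {E : Type} [Fintype E] [Nonempty E]
    (μ : E → ℝ) (hμ : ∀ m, 0 < μ m) (hsum : ∑ m, μ m = 1) (α : E → ℝ) (γ : ℝ)
    (x : ℝ) (hx : 0 ≤ x) (k : E) :
    -- (1) γ > 0, γ ≥ α_m for all m, J = {m | α_m = γ} nonempty
    ((0 < γ → (∀ m, α m ≤ γ) → (∃ m, α m = γ) →
      Tendsto (fun u : ℝ => Zstar μ α γ x k u /
          (2 * (∑ m, if α m = γ then μ m else 0) * u * γ ^ 2
            * Real.exp (-γ * x + u * γ ^ 2 / 2)))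
        atTop (nhds 1))) ∧
    -- (2) γ > 0, γ > α_m for all m
    ((0 < γ → (∀ m, α m < γ) →
      Tendsto (fun u : ℝ => Zstar μ α γ x k u /
          ((∑ m, 2 * γ * μ m / (γ - α m)) * Real.exp (-γ * x + u * γ ^ 2 / 2)))
        atTop (nhds 1))) ∧
    -- (3) ᾱ = max α > γ and ᾱ > 0, J = {m | α_m = ᾱ}
    ((γ < Finset.univ.sup' Finset.univ_nonempty α →
      0 < Finset.univ.sup' Finset.univ_nonempty α →
      Tendsto (fun u : ℝ => Zstar μ α γ x k u /
          (Real.exp (u * (Finset.univ.sup' Finset.univ_nonempty α) ^ 2 / 2) *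
            ((2 * Finset.univ.sup' Finset.univ_nonempty α /
                (Finset.univ.sup' Finset.univ_nonempty α - γ)) *
              (∑ m, if α m = Finset.univ.sup' Finset.univ_nonempty α then μ m else 0) *
              Real.exp (-(Finset.univ.sup' Finset.univ_nonempty α) * x) +
            2 * Real.sinh (Finset.univ.sup' Finset.univ_nonempty α * x) *
              (if α k = Finset.univ.sup' Finset.univ_nonempty α then 1 else 0))))
        atTop (nhds 1))) ∧
    -- (4) γ = 0, J = {m | α_m = 0} nonempty, α_m < 0 off J
    ((γ = 0 → (∃ m, α m = 0) → (∀ m, α m ≠ 0 → α m < 0) →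
      Tendsto (fun u : ℝ => Zstar μ α γ x k u /
          (∑ m, if α m = 0 then μ m else 0))
        atTop (nhds 1))) ∧
    -- (5) γ = 0, α_m < 0 for all m
    ((γ = 0 → (∀ m, α m < 0) →
      Tendsto (fun u : ℝ => Zstar μ α γ x k u /
          (Real.sqrt (2 / (Real.pi * u)) * ∑ m, μ m / |α m|))
        atTop (nhds 1))) ∧
    -- (6) γ < 0, J = {m | α_m = 0} nonempty, α_m < 0 off J
    ((γ < 0 → (∃ m, α m = 0) → (∀ m, α m ≠ 0 → α m < 0) →
      Tendsto (fun u : ℝ => Zstar μ α γ x k u /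
          (Real.sqrt (2 / (Real.pi * u)) *
            ((∑ m, if α m = 0 then μ m else 0) / |γ| + x * (if α k = 0 then 1 else 0))))
        atTop (nhds 1))) ∧
    -- (7) γ < 0, α_m < 0 for all m
    ((γ < 0 → (∀ m, α m < 0) →
      Tendsto (fun u : ℝ => Zstar μ α γ x k u /
          (Real.sqrt (2 / (Real.pi * u ^ 3)) *
            ((∑ m, μ m * (|α m| + |γ|) / ((α m) ^ 2 * γ ^ 2)) +
              x * (1 / (α k) ^ 2 + ∑ m, μ m / (α m * γ)))))
        atTop (nhds 1))) := by
  have hμ0 : ∀ m, 0 ≤ μ m := fun m => (hμ m).le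
  have hmass : ∀ a : ℝ, (∃ m, α m = a) → 0 < ∑ m, if α m = a then μ m else 0 := by
    rintro a ⟨m, hm⟩
    refine Finset.sum_pos' (fun i _ => ?_) ⟨m, Finset.mem_univ m, ?_⟩
    · split_ifs
      exacts [hμ0 i, le_rfl]
    · simpa [hm] using hμ m
  have hweight : ∀ a c : ℝ, ∑ m, μ m * (if α m = a then c else 0) =
      c * ∑ m, if α m = a then μ m else 0 := by
    intro a c
    rw [Finset.mul_sum]
    refine Finset.sum_congr rfl fun m _ => ?_
    split_ifs <;> ring
  have hexp : ∀ A : ℝ, ∀ᶠ u : ℝ in atTop, Real.exp (u * A ^ 2 / 2) ≠ 0 :=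
    fun A => Eventually.of_forall fun u => Real.exp_ne_zero _
  have hsqrt : ∀ᶠ u : ℝ in atTop, Real.sqrt (2 / (Real.pi * u)) ≠ 0 := by
    filter_upwards [eventually_gt_atTop 0] with u hu
    positivity
  have hsqrt3 : ∀ᶠ u : ℝ in atTop, Real.sqrt (2 / (Real.pi * u ^ 3)) ≠ 0 := by
    filter_upwards [eventually_gt_atTop 0] with u hu
    positivity
  refine ⟨?_, ?_, ?_, ?_, ?_, ?_, ?_⟩
  · intro hγ hα hJ
    have hS := hmass γ hJ
    refine tendsto_Zstar_div (d := fun u => u * Real.exp (u * γ ^ 2 / 2))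
      (c := fun m => if α m = γ then 2 * γ ^ 2 * Real.exp (-γ * x) else 0) (j := 0)
      ?_ (fun m => ?_) ?_ rfl ?_ (fun u => ?_)
    · filter_upwards [eventually_gt_atTop 0] with u hu
      positivity
    · split_ifs with h
      · rw [h]
        exact Istar_leading_self hγ x
      · simpa using isLittleO_const_id_mul
          (Istar_isBigO_of_lt_right hγ (lt_of_le_of_ne (hα m) h) x)
    · simp only [zero_mul, sub_zero]
      rcases (hα k).lt_or_eq with h | h
      · exact isLittleO_const_id_mul (Jstar_isLittleO_exp h hγ x).isBigO
      · rw [h]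
        exact isLittleO_const_id_mul (Jstar_isBigO_exp hγ x)
    · rw [hweight]
      positivity
    · rw [hweight, Real.exp_add]
      ring
  · intro hγ hα
    have hpos : 0 < ∑ m, 2 * γ * μ m / (γ - α m) :=
      Finset.sum_pos (fun m _ => div_pos (mul_pos (by positivity) (hμ m)) (sub_pos.2 (hα m)))
        Finset.univ_nonempty
    refine tendsto_Zstar_div (d := fun u => Real.exp (u * γ ^ 2 / 2))
      (c := fun m => 2 * γ / (γ - α m) * Real.exp (-γ * x)) (j := 0)
      (C := (∑ m, 2 * γ * μ m / (γ - α m)) * Real.exp (-γ * x))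
      (hexp γ) (fun m => Istar_leading_of_lt_right hγ (hα m) x) ?_ ?_ (by positivity) (fun u => ?_)
    · simpa using Jstar_isLittleO_exp (hα k) hγ x
    · rw [add_zero, Finset.sum_mul]
      exact Finset.sum_congr rfl fun m _ => by ring
    · rw [Real.exp_add]
      ring
  · obtain ⟨m₀, -, hm₀⟩ := Finset.exists_mem_eq_sup' Finset.univ_nonempty α
    have hle : ∀ m, α m ≤ Finset.univ.sup' Finset.univ_nonempty α :=
      fun m => Finset.le_sup' α (Finset.mem_univ m)
    generalize Finset.univ.sup' Finset.univ_nonempty α = A at hm₀ hle ⊢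
    intro hγ hA
    have hS := hmass A ⟨m₀, hm₀.symm⟩
    have hsub : 0 < A - γ := sub_pos.2 hγ
    have hsinh : 0 ≤ Real.sinh (A * x) := Real.sinh_nonneg_iff.2 (by positivity)
    refine tendsto_Zstar_div (d := fun u => Real.exp (u * A ^ 2 / 2))
      (c := fun m => if α m = A then 2 * A / (A - γ) * Real.exp (-A * x) else 0)
      (j := 2 * Real.sinh (A * x) * if α k = A then 1 else 0)
      (hexp A) (fun m => ?_) ?_ ?_ ?_ (fun u => rfl)
    · split_ifs with h
      · rw [h]
        exact Istar_leading_of_lt_left hA hγ x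
      · simpa using Istar_isLittleO_exp (lt_of_le_of_ne (hle m) h) hγ hA x
    · split_ifs with h
      · rw [h, mul_one]
        exact Jstar_leading_of_pos hA x
      · simpa using Jstar_isLittleO_exp (lt_of_le_of_ne (hle k) h) hA x
    · rw [hweight]
      ring
    · refine add_pos_of_pos_of_nonneg (by positivity) (mul_nonneg (by positivity) ?_)
      split_ifs <;> norm_num
  · rintro rfl hJ hα
    have hα' : ∀ m, α m ≤ 0 := fun m => (eq_or_ne (α m) 0).elim le_of_eq fun h => (hα m h).le
    refine tendsto_Zstar_div (d := fun _ => 1) (c := fun m => if α m = 0 then 1 else 0) (j := 0)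
      (by simp) (fun m => ?_) ?_ ?_ (hmass 0 hJ) (fun u => (one_mul _).symm)
    · split_ifs with h
      · simp only [h, Istar_zero_zero, mul_one, sub_self]
        exact Asymptotics.isLittleO_zero _ _
      · simp only [Istar_of_neg_zero (hα m h), zero_mul, sub_zero]
        exact isLittleO_sqrt_two_div_pi_mul_one.const_mul_left _
    · simpa only [zero_mul, sub_zero] using Jstar_isLittleO_one_of_nonpos (hα' k) x
    · rw [hweight]
      ring
  · rintro rfl hα
    refine tendsto_Zstar_div (d := fun u => Real.sqrt (2 / (Real.pi * u)))
      (c := fun m => 1 / |α m|) (j := 0)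
      hsqrt (fun m => ?_) ?_ ?_ ?_ (fun u => rfl)
    · simp only [Istar_of_neg_zero (hα m), sub_self]
      exact Asymptotics.isLittleO_zero _ _
    · simpa only [zero_mul, sub_zero] using Jstar_isLittleO_sqrt_of_neg (hα k) x
    · simp [div_eq_mul_inv]
    · exact Finset.sum_pos (fun m _ => div_pos (hμ m) (abs_pos.2 (hα m).ne))
        Finset.univ_nonempty
  · intro hγ hJ hα
    have hS := hmass 0 hJ
    refine tendsto_Zstar_div (d := fun u => Real.sqrt (2 / (Real.pi * u)))
      (c := fun m => if α m = 0 then 1 / |γ| else 0) (j := x * if α k = 0 then 1 else 0)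
      hsqrt (fun m => ?_) ?_ ?_ ?_ (fun u => rfl)
    · split_ifs with h
      · simp only [h, Istar_zero_of_neg hγ, sub_self]
        exact Asymptotics.isLittleO_zero _ _
      · simp only [Istar_of_neg_of_neg (hα m h) hγ, zero_mul, sub_zero]
        exact isLittleO_sqrt_two_div_pi_mul_cube.const_mul_left _
    · split_ifs with h
      · simp only [h, Jstar_zero, mul_one, mul_comm _ x, sub_self]
        exact Asymptotics.isLittleO_zero _ _
      · simpa using Jstar_isLittleO_sqrt_of_neg (hα k h) x
    · rw [hweight]
      ring
    · refine add_pos_of_pos_of_nonneg (div_pos hS (abs_pos.2 hγ.ne)) (mul_nonneg hx ?_)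
      split_ifs <;> norm_num
  · intro hγ hα
    refine tendsto_Zstar_div (d := fun u => Real.sqrt (2 / (Real.pi * u ^ 3)))
      (c := fun m => x / (α m * γ) + (|α m| + |γ|) / (α m ^ 2 * γ ^ 2)) (j := x / α k ^ 2)
      hsqrt3 (fun m => ?_) ?_ ?_ ?_ (fun u => rfl)
    · simp only [Istar_of_neg_of_neg (hα m) hγ, sub_self]
      exact Asymptotics.isLittleO_zero _ _
    · simp only [Jstar_of_neg (hα k), sub_self]
      exact Asymptotics.isLittleO_zero _ _
    · have h : ∑ m, μ m * (x / (α m * γ) + (|α m| + |γ|) / (α m ^ 2 * γ ^ 2)) =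
          x * ∑ m, μ m / (α m * γ) + ∑ m, μ m * (|α m| + |γ|) / (α m ^ 2 * γ ^ 2) := by
        rw [Finset.mul_sum, ← Finset.sum_add_distrib]
        exact Finset.sum_congr rfl fun m _ => by ring
      rw [h]
      ring
    · refine add_pos_of_pos_of_nonneg (Finset.sum_pos (fun m _ => ?_) Finset.univ_nonempty)
        (mul_nonneg hx (add_nonneg (by positivity) (Finset.sum_nonneg fun m _ => ?_)))
      · have h1 := hμ m
        have h2 := (hα m).ne
        have h3 := hγ.ne
        positivity
      · exact div_nonneg (hμ0 m) (mul_pos_of_neg_of_neg (hα m) hγ).le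


end
end
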